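/- For every natural number n ≥ 7 with n ≠ 13 and every prime p with 3 < p ≤ n, there exists a group word w_p in the free group F_3 on three generators such that the set of values (Alt(n))_{w_p} of w_p in the alternating group Alt(n) consists exactly of the identity and all p-cycles. -/

import Mathlib

/-- The set of values of a word `w ∈ F_d` in a group `G`:
`G_w = { w(g₁,…,g_d)^{±1} : gᵢ ∈ G }`. -/
def wordValues {d : ℕ} (w : FreeGroup (Fin d)) (G : Type*) [Group G] : Set G :=
  {g | ∃ f : Fin d → G, FreeGroup.lift f w = g ∨ FreeGroup.lift f w = g⁻¹}

open Equiv Equiv.Perm in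
open scoped Fin.NatCast in
lemma aux_gen (m : ℕ) : ∃ f : Fin 3 → alternatingGroup (Fin (m+3)),
    Function.Surjective (FreeGroup.lift f) := by
  set s : ℕ → Perm (Fin (m+3)) := fun i => swap (i : Fin (m+3)) ((i+1 : ℕ) : Fin (m+3)) with hs
  set r : Perm (Fin (m+3)) := Equiv.addRight 1 with hr
  have hne : ∀ i : ℕ, (i : Fin (m+3)) ≠ ((i+1 : ℕ) : Fin (m+3)) := by
    intro i h
    have : (1 : Fin (m+3)) = 0 := by
      push_cast at h
      simpa using h.symm
    simp [Fin.ext_iff] at this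
  have hsign : ∀ i, sign (s i) = -1 := fun i => sign_swap (hne i)
  have hss : ∀ i, s i * s i = 1 := fun i => swap_mul_self _ _
  have hconj : ∀ i, r * s i * r⁻¹ = s (i+1) := by
    intro i
    simp only [hs, hr]
    rw [← swap_apply_apply]
    simp
  have hmem : ∀ i, s i * s (i+1) ∈ alternatingGroup (Fin (m+3)) := by
    intro i
    rw [mem_alternatingGroup, map_mul, hsign, hsign]; rfl
  have hrm : r * r ∈ alternatingGroup (Fin (m+3)) := by
    rw [mem_alternatingGroup, map_mul]
    exact Int.units_mul_self _
  let f : Fin 3 → alternatingGroup (Fin (m+3)) := ![⟨_, hmem 0⟩, ⟨_, hmem 1⟩, ⟨_, hrm⟩]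
  refine ⟨f, ?_⟩
  set H : Subgroup (Perm (Fin (m+3))) :=
    ((FreeGroup.lift f).range).map (alternatingGroup (Fin (m+3))).subtype with hH
  have hf : ∀ i, (f i : Perm (Fin (m+3))) ∈ H := fun i =>
    ⟨f i, ⟨FreeGroup.of i, by simp⟩, rfl⟩
  have h0 : s 0 * s 1 ∈ H := hf 0
  have h1 : s 1 * s 2 ∈ H := hf 1
  have h2 : r * r ∈ H := hf 2
  have hu : ∀ i, s i * s (i+1) ∈ H ∧ s (i+1) * s (i+2) ∈ H := by
    intro i
    induction i with
    | zero => exact ⟨h0, h1⟩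
    | succ i ih =>
      refine ⟨ih.2, ?_⟩
      have := H.mul_mem (H.mul_mem h2 ih.1) (H.inv_mem h2)
      convert this using 1
      have e1 := hconj (i+1+1)
      have e2 := hconj (i+1)
      have e3 := hconj i
      rw [show i+1+2 = i+1+1+1 from rfl, ← e1, ← e2, ← e3]
      group
  have hv : ∀ i, s 0 * s i ∈ H := by
    intro i
    induction i with
    | zero => rw [hss]; exact H.one_mem
    | succ i ih =>
      have := H.mul_mem ih (hu i).1
      rwa [mul_assoc, ← mul_assoc (s i), hss, one_mul] at this
  have hinv : ∀ i, (s i)⁻¹ = s i := fun i => swap_inv _ _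
  have hv' : ∀ i, s i * s 0 ∈ H := by
    intro i
    have := H.inv_mem (hv i)
    rwa [mul_inv_rev, hinv, hinv] at this
  have hall : ∀ σ : Perm (Fin (m+3)), σ ∈ H ∨ σ * s 0 ∈ H := by
    intro σ
    have : σ ∈ Submonoid.closure (Set.range fun i : Fin (m+2) ↦ swap i.castSucc i.succ) := by
      rw [mclosure_swap_castSucc_succ]; trivial
    induction this using Submonoid.closure_induction_right with
    | one => exact Or.inl H.one_mem
    | mul_right x hx y hy ih =>
      obtain ⟨i, rfl⟩ := hy
      have e : swap i.castSucc i.succ = s i := by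
        have : ((i : ℕ) : Fin (m+3)) = i.castSucc := by
          ext; simp [Nat.mod_eq_of_lt (show (i:ℕ) < m+3 by omega)]
        have h' : (((i : ℕ)+1 : ℕ) : Fin (m+3)) = i.succ := by
          ext; simp only [Fin.val_natCast, Fin.val_succ]; exact Nat.mod_eq_of_lt (by omega)
        simp only [hs]
        rw [this, h']
      simp only [e]
      rcases ih with ih | ih
      · right
        rw [mul_assoc]; exact H.mul_mem ih (hv' i)
      · left
        have := H.mul_mem ih (hv i)
        rwa [mul_assoc, ← mul_assoc (s 0), hss, one_mul] at this
  have hle : ∀ σ ∈ H, sign σ = 1 := by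
    rintro _ ⟨g, -, rfl⟩
    exact g.2
  intro g
  have : (g : Perm (Fin (m+3))) ∈ H := by
    rcases hall g with h | h
    · exact h
    · exfalso
      have h3 := hle _ h
      rw [map_mul, hsign, show sign (g : Perm (Fin (m+3))) = 1 from g.2] at h3
      exact absurd h3 (by decide)
  obtain ⟨g', ⟨w, hw⟩, hg⟩ := this
  exact ⟨w, hw.trans (Subtype.ext hg)⟩

lemma aux_word {G : Type*} [Group G] [Finite G] [IsSimpleGroup G] (hc : commutator G = ⊤)
    (f₀ : Fin 3 → G) (hs : Function.Surjective (FreeGroup.lift f₀)) (c : G) :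
    ∃ w : FreeGroup (Fin 3), FreeGroup.lift f₀ w = c ∧
      ∀ f : Fin 3 → G, FreeGroup.lift f w = 1 ∨ ∃ φ : G ≃* G, f = φ ∘ f₀ := by
  classical
  have := Fintype.ofFinite (Fin 3 → G)
  have key : ∀ f : Fin 3 → G, (¬ ∃ φ : G ≃* G, f = φ ∘ f₀) →
      (FreeGroup.lift f).ker.map (FreeGroup.lift f₀) = ⊤ := by
    intro f hf
    have hn : ((FreeGroup.lift f).ker.map (FreeGroup.lift f₀)).Normal :=
      Subgroup.Normal.map inferInstance _ hs
    rcases hn.eq_bot_or_eq_top with h | h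
    · exfalso
      apply hf
      have hker : (FreeGroup.lift f).ker ≤ (FreeGroup.lift f₀).ker := by
        rw [← Subgroup.map_eq_bot_iff]; exact h
      -- section
      choose q hq using hs
      have hinj : Function.Injective fun g => FreeGroup.lift f (q g) := by
        intro a b hab
        have : (q a)⁻¹ * q b ∈ (FreeGroup.lift f₀).ker := hker (by
          rw [MonoidHom.mem_ker, map_mul, map_inv]
          simp only at hab
          rw [hab, inv_mul_cancel])
        rw [MonoidHom.mem_ker, map_mul, map_inv, hq, hq, inv_mul_eq_one] at this
        exact this
      have hsurj := Finite.surjective_of_injective hinj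
      have hfs : Function.Surjective (FreeGroup.lift f) := fun g => by
        obtain ⟨a, ha⟩ := hsurj g
        exact ⟨q a, ha⟩
      let ψ : G →* G := (FreeGroup.lift f).liftOfSurjective hfs ⟨FreeGroup.lift f₀, hker⟩
      have hψ : ∀ x, ψ (FreeGroup.lift f x) = FreeGroup.lift f₀ x := fun x =>
        MonoidHom.liftOfRightInverse_comp_apply _ _ _ ⟨FreeGroup.lift f₀, hker⟩ x
      have hψs : Function.Surjective ψ := fun g => ⟨_, (hψ (q g)).trans (hq g)⟩
      have hψb : Function.Bijective ψ := ⟨Finite.injective_iff_surjective.2 hψs, hψs⟩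
      refine ⟨(MulEquiv.ofBijective ψ hψb).symm, ?_⟩
      funext i
      simp only [Function.comp]
      rw [MulEquiv.eq_symm_apply]
      have := hψ (FreeGroup.of i)
      simpa using this
    · exact h
  have main : ∀ S : Finset (Fin 3 → G), (∀ f ∈ S, ¬ ∃ φ : G ≃* G, f = φ ∘ f₀) →
      ∃ N : Subgroup (FreeGroup (Fin 3)), N.Normal ∧ N.map (FreeGroup.lift f₀) = ⊤ ∧
        ∀ f ∈ S, N ≤ (FreeGroup.lift f).ker := by
    intro S
    induction S using Finset.induction_on with
    | empty =>
      intro _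
      exact ⟨⊤, inferInstance, by rw [← MonoidHom.range_eq_map]; exact MonoidHom.range_eq_top.2 hs,
        by simp⟩
    | insert a S ha ih =>
      intro h
      obtain ⟨N, hN, hN1, hN2⟩ := ih fun f hf => h f (Finset.mem_insert_of_mem hf)
      refine ⟨N ⊓ (FreeGroup.lift a).ker, inferInstance, ?_, ?_⟩
      · rw [eq_top_iff, ← hc]
        calc commutator G = ⁅N.map (FreeGroup.lift f₀),
              (FreeGroup.lift a).ker.map (FreeGroup.lift f₀)⁆ := by
              rw [hN1, key a (h a (Finset.mem_insert_self _ _))]; rfl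
          _ = (⁅N, (FreeGroup.lift a).ker⁆).map (FreeGroup.lift f₀) :=
              (Subgroup.map_commutator _ _ _).symm
          _ ≤ _ := Subgroup.map_mono (Subgroup.commutator_le_inf _ _)
      · intro f hf
        rcases Finset.mem_insert.1 hf with rfl | hf
        · exact inf_le_right
        · exact inf_le_left.trans (hN2 f hf)
  obtain ⟨N, -, hN1, hN2⟩ := main (Finset.univ.filter fun f => ¬ ∃ φ : G ≃* G, f = φ ∘ f₀)
    (fun f hf => (Finset.mem_filter.1 hf).2)
  have hcm : c ∈ N.map (FreeGroup.lift f₀) := by rw [hN1]; trivial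
  obtain ⟨w, hw, hwc⟩ := hcm
  refine ⟨w, hwc, fun f => ?_⟩
  by_cases h : ∃ φ : G ≃* G, f = φ ∘ f₀
  · exact Or.inr h
  · exact Or.inl (hN2 f (by simpa using h) hw)

open Nat in
lemma aux_ineq (p m j : ℕ) (hp : 5 ≤ p) (hj : 1 ≤ j) :
    2 * (m ! * p ^ j * (j + 1)!) < (m + j * p)! := by
  induction j, hj using Nat.le_induction with
  | base =>
    have h1 : m ! * p ! ≤ (m + p)! :=
      Nat.le_of_dvd (Nat.factorial_pos _) (Nat.factorial_mul_factorial_dvd_factorial_add m p)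
    have h2 : 4 * p < p ! := by
      obtain ⟨q, rfl⟩ : ∃ q, p = q + 1 := ⟨p - 1, by omega⟩
      rw [Nat.factorial_succ]
      have : 4 ! ≤ q ! := Nat.factorial_le (by omega)
      have h24 : (4 : ℕ)! = 24 := rfl
      nlinarith
    have h3 := Nat.factorial_pos m
    have h4 : m ! * (4 * p) < m ! * p ! := Nat.mul_lt_mul_of_pos_left h2 h3
    have h5 : (1+1)! = 2 := rfl
    rw [h5, one_mul, pow_one]
    nlinarith
  | succ j hj ih =>
    have h1 : (m + j * p)! * (m + j * p + 1) ^ p ≤ (m + j * p + p)! :=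
      Nat.factorial_mul_pow_le_factorial
    have h2 : p * (j + 2) ≤ (m + j * p + 1) ^ p := by
      calc p * (j+2) ≤ (m + j * p + 1) ^ 2 := by
            have : p ≤ j * p := Nat.le_mul_of_pos_left p hj
            nlinarith [Nat.zero_le (m * (j*p)), Nat.zero_le (m*m)]
        _ ≤ _ := Nat.pow_le_pow_right (by omega) (by omega)
    have e : m + (j+1) * p = m + j * p + p := by ring
    rw [e]
    refine lt_of_lt_of_le ?_ h1
    calc 2 * (m ! * p ^ (j+1) * (j+1+1)!) = 2 * (m ! * p ^ j * (j + 1)!) * (p * (j+2)) := by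
          rw [Nat.factorial_succ (j+1)]; ring
      _ < (m + j * p)! * (p * (j+2)) := Nat.mul_lt_mul_of_pos_right ih (by positivity)
      _ ≤ _ := Nat.mul_le_mul_left _ h2

open Equiv Equiv.Perm in
lemma aux_cent {n : ℕ} (hn : 2 ≤ n) (g : alternatingGroup (Fin n)) :
    Nat.card (Subgroup.centralizer {g}) ≤ Nat.card (Subgroup.centralizer {(g : Perm (Fin n))}) ∧
    Nat.card (Subgroup.centralizer {(g : Perm (Fin n))}) ≤
      2 * Nat.card (Subgroup.centralizer {g}) := by
  let A := alternatingGroup (Fin n)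
  let C := Subgroup.centralizer {(g : Perm (Fin n))}
  have : Nontrivial (Fin n) := Fin.nontrivial_iff_two_le.2 hn
  have e : Subgroup.centralizer {g} = C.subgroupOf A := by
    ext x
    simp only [Subgroup.mem_subgroupOf, C, Subgroup.mem_centralizer_singleton_iff, Subtype.ext_iff]
    rfl
  have e1 : Nat.card (Subgroup.centralizer {g}) = Nat.card (A.subgroupOf C) := by
    rw [e]
    refine Nat.card_congr ⟨fun x => ⟨⟨x.1.1, x.2⟩, x.1.2⟩, fun x => ⟨⟨x.1.1, x.2⟩, x.1.2⟩,
      fun _ => rfl, fun _ => rfl⟩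
  have e2 := (A.subgroupOf C).index_mul_card
  have e3 : (A.subgroupOf C).index ∣ 2 := by
    have := A.relIndex_dvd_index_of_normal C
    rwa [alternatingGroup.index_eq_two] at this
  have e4 := Nat.le_of_dvd (by norm_num) e3
  change _ ≤ Nat.card C ∧ Nat.card C ≤ _
  rw [e1, ← e2]
  refine ⟨Nat.le_mul_of_pos_left _ (Nat.pos_of_dvd_of_pos e3 (by norm_num)),
    Nat.mul_le_mul_right _ e4⟩

open Equiv Equiv.Perm in
open scoped Nat in
lemma aux_aut {n p : ℕ} (hn : 2 ≤ n) (hp : p.Prime) (hp5 : 5 ≤ p)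
    (ψ : alternatingGroup (Fin n) ≃* alternatingGroup (Fin n)) (g : alternatingGroup (Fin n))
    (hg : (g : Perm (Fin n)).IsCycle) (hgp : (g : Perm (Fin n)).support.card = p) :
    (ψ g : Perm (Fin n)).IsCycle ∧ (ψ g : Perm (Fin n)).support.card = p := by
  have ho : orderOf (ψ g : Perm (Fin n)) = p := by
    rw [Subgroup.orderOf_coe, MulEquiv.orderOf_eq, ← Subgroup.orderOf_coe, hg.orderOf, hgp]
  obtain ⟨j, hj⟩ := cycleType_prime_order (σ := (ψ g : Perm (Fin n))) (by rw [ho]; exact hp)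
  rw [ho] at hj
  have hle : (j + 1) * p ≤ n := by
    have := (ψ g : Perm (Fin n)).sum_cycleType
    rw [hj, Multiset.sum_replicate, smul_eq_mul] at this
    rw [this]
    simpa using Finset.card_le_univ (ψ g : Perm (Fin n)).support
  have hcard : Nat.card (Subgroup.centralizer {ψ g}) = Nat.card (Subgroup.centralizer {g}) := by
    symm
    refine Nat.card_congr (ψ.toEquiv.subtypeEquiv fun x => ?_)
    simp only [Subgroup.mem_centralizer_singleton_iff]
    change x * g = g * x ↔ ψ x * ψ g = ψ g * ψ x
    rw [← map_mul, ← map_mul, ψ.injective.eq_iff]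
  have c1 := nat_card_centralizer (g : Perm (Fin n))
  have c2 := nat_card_centralizer (ψ g : Perm (Fin n))
  rw [hg.cycleType, hgp] at c1
  rw [hj] at c2
  have hj0 : j = 0 := by
    by_contra hj0
    have hj1 : 1 ≤ j := by omega
    have hi := aux_ineq p (n - (j+1) * p) j hp5 hj1
    have a1 := aux_cent hn g
    have a2 := aux_cent hn (ψ g)
    have e : n - (j+1) * p + j * p = n - p := by
      have : (j+1) * p = j * p + p := by ring
      omega
    rw [e] at hi
    simp only [Multiset.toFinset_replicate, Multiset.sum_replicate, Multiset.prod_replicate,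
      Fintype.card_fin, smul_eq_mul] at c2
    simp at c1
    simp at c2
    have hpp : 0 < p := hp.pos
    have hi2 := Nat.mul_lt_mul_of_pos_right hi hpp
    have : (n - (j+1)*p)! * p ^ (j+1) * (j+1)! = (n - (j + 1) * p)! * p ^ j * (j + 1)! * p := by ring
    rw [this] at c2
    rw [mul_assoc, ← c1, ← c2] at hi2
    omega
  subst hj0
  constructor
  · rw [← card_cycleType_eq_one, hj]; simp
  · rw [← sum_cycleType, hj]; simp

theorem stmt7 (n : ℕ) (hn : 7 ≤ n) (h13 : n ≠ 13)
    (p : ℕ) (hp : p.Prime) (hp3 : 3 < p) (hpn : p ≤ n) :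
    ∃ w : FreeGroup (Fin 3),
      wordValues w (alternatingGroup (Fin n)) =
        {g : alternatingGroup (Fin n) | g = 1 ∨
          ((g : Equiv.Perm (Fin n)).IsCycle ∧ (g : Equiv.Perm (Fin n)).support.card = p)} := by
  have hp5 : 5 ≤ p := by
    rcases Nat.lt_or_ge p 5 with h | h
    · obtain rfl : p = 4 := by omega
      exact absurd hp (by norm_num)
    · exact h
  by_cases hex : ∃ c : alternatingGroup (Fin n),
      (c : Equiv.Perm (Fin n)).IsCycle ∧ (c : Equiv.Perm (Fin n)).support.card = p
  · obtain ⟨c, hc1, hc2⟩ := hex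
    have h5 : 5 ≤ Nat.card (Fin n) := by simp; omega
    have : IsSimpleGroup (alternatingGroup (Fin n)) := alternatingGroup.isSimpleGroup h5
    obtain ⟨f₀, hf₀⟩ : ∃ f : Fin 3 → alternatingGroup (Fin n),
        Function.Surjective (FreeGroup.lift f) := by
      obtain ⟨m, rfl⟩ : ∃ m, n = m + 3 := ⟨n - 3, by omega⟩
      exact aux_gen m
    obtain ⟨w, hw, hw'⟩ := aux_word (commutator_alternatingGroup_eq_top h5) f₀ hf₀ c
    have hφ : ∀ φ : alternatingGroup (Fin n) ≃* alternatingGroup (Fin n),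
        FreeGroup.lift (φ ∘ f₀) w = φ c := by
      intro φ
      have : FreeGroup.lift (φ ∘ f₀) = φ.toMonoidHom.comp (FreeGroup.lift f₀) := by
        ext i; simp
      rw [this, ← hw]; rfl
    refine ⟨w, Set.ext fun g => ⟨?_, ?_⟩⟩
    · rintro ⟨f, hf⟩
      rcases hw' f with h | ⟨φ, rfl⟩
      · rw [h] at hf
        left
        rcases hf with h | h
        · exact h.symm
        · exact inv_eq_one.1 h.symm
      · right
        have := aux_aut (by omega) hp hp5 φ c hc1 hc2
        rw [hφ] at hf
        rcases hf with h | h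
        · rwa [h] at this
        · rw [h] at this
          simpa using this
    · rintro (rfl | ⟨h1, h2⟩)
      · refine ⟨1, Or.inl ?_⟩
        have : FreeGroup.lift (1 : Fin 3 → alternatingGroup (Fin n)) = 1 := by ext i; simp
        rw [this]; rfl
      · obtain ⟨σ, hσ⟩ := isConj_iff.1 (hc1.isConj h1 (hc2.trans h2.symm))
        refine ⟨(MulAut.conjNormal σ : MulAut (alternatingGroup (Fin n))) ∘ f₀, Or.inl ?_⟩
        rw [hφ]
        ext1
        rw [MulAut.conjNormal_apply]
        exact hσ
  · refine ⟨1, Set.ext fun g => ⟨?_, ?_⟩⟩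
    · rintro ⟨f, hf⟩
      left
      rcases hf with h | h
      · simpa using h.symm
      · simpa using h.symm
    · rintro (rfl | h)
      · exact ⟨1, Or.inl (by simp)⟩
      · exact absurd ⟨g, h⟩ hex
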